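/- Every copula C on [0,1]^d that is absolutely continuous with respect to Lebesgue measure can be approximated arbitrarily well in Hellinger distance by grid-uniform copulas: for all ε > 0 there is a grid ρ with H(C, C_ρ) < ε. -/

import Mathlib

open MeasureTheory Set

/-- An orthogonal grid of `[0,1]^d`: for each coordinate a strictly increasing
finite sequence of points starting at `0` and ending at `1`. -/
structure Grid (d : ℕ) where
  n : Fin d → ℕ
  npos : ∀ i, 0 < n i
  pts : (i : Fin d) → Fin (n i + 1) → ℝ
  mono : ∀ i, StrictMono (pts i)
  first : ∀ i, pts i 0 = 0
  last : ∀ i, pts i (Fin.last (n i)) = 1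

variable {d : ℕ}

/-- Index set of the cells of a grid. -/
abbrev Grid.CellIdx (g : Grid d) := (i : Fin d) → Fin (g.n i)

/-- The half-open rectangular cell of the grid with upper-right corner indexed by `k`. -/
def Grid.cell (g : Grid d) (k : g.CellIdx) : Set (Fin d → ℝ) :=
  Set.univ.pi fun i => Set.Ioc (g.pts i (k i).castSucc) (g.pts i (k i).succ)

/-- The measure on `[0,1]^d` assigning mass `w k` to cell `k`,
distributed uniformly (proportionally to Lebesgue measure) within each cell. -/
noncomputable def Grid.massMeasure (g : Grid d) (w : g.CellIdx → ℝ) :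
    Measure (Fin d → ℝ) :=
  Measure.sum fun k : g.CellIdx =>
    (ENNReal.ofReal (w k) / volume (g.cell k)) • volume.restrict (g.cell k)

/-- The grid-uniform version `C_ρ` of a measure `C`: each cell `B` receives the
mass `C(B)`, distributed uniformly within the cell. -/
noncomputable def Grid.gridUniform (g : Grid d) (μ : Measure (Fin d → ℝ)) :
    Measure (Fin d → ℝ) :=
  Measure.sum fun k : g.CellIdx =>
    (μ (g.cell k) / volume (g.cell k)) • volume.restrict (g.cell k)

/-- A copula: a probability measure on `ℝ^d` each of whose one-dimensional
marginals is the uniform distribution on `[0,1]`. -/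
def IsCopula {d : ℕ} (μ : Measure (Fin d → ℝ)) : Prop :=
  IsProbabilityMeasure μ ∧
    ∀ i : Fin d, μ.map (fun x => x i) = volume.restrict (Set.Icc (0:ℝ) 1)

/-- Squared Hellinger distance between two measures on `ℝ^d` (intended for
measures absolutely continuous w.r.t. Lebesgue measure), computed from their
Radon–Nikodym derivatives with respect to Lebesgue measure. -/
noncomputable def hellingerSq {d : ℕ} (μ ν : Measure (Fin d → ℝ)) : ℝ :=
  (1/2) * ∫ x, (Real.sqrt ((μ.rnDeriv volume x).toReal) -
    Real.sqrt ((ν.rnDeriv volume x).toReal)) ^ 2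

/-- The `L¹` distance of an integrable function from its mean is at most twice its `L¹` distance
from any constant. -/
lemma setIntegral_abs_sub_average_le {α : Type*} [MeasurableSpace α] {μ : Measure α} {s : Set α}
    (hs0 : μ.real s ≠ 0) (hs : μ s ≠ ⊤) {f : α → ℝ} (hf : IntegrableOn f s μ) (a : ℝ) :
    ∫ x in s, |f x - (∫ y in s, f y ∂μ) / μ.real s| ∂μ ≤ 2 * ∫ x in s, |f x - a| ∂μ := by
  have hconst : ∀ c : ℝ, IntegrableOn (fun _ => c) s μ := fun c => integrableOn_const hs
  set m := (∫ y in s, f y ∂μ) / μ.real s with hm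
  have hfa : ∀ c : ℝ, IntegrableOn (fun x => |f x - c|) s μ := fun c => (hf.sub (hconst c)).abs
  have hpos : 0 < μ.real s := lt_of_le_of_ne measureReal_nonneg hs0.symm
  have h1 : μ.real s * |a - m| ≤ ∫ x in s, |f x - a| ∂μ := by
    have : ∫ x in s, (f x - a) ∂μ = μ.real s * (m - a) := by
      rw [integral_sub hf (hconst a), setIntegral_const, smul_eq_mul, hm]
      field_simp
    calc μ.real s * |a - m| = |∫ x in s, (f x - a) ∂μ| := by
          rw [this, abs_mul, abs_of_pos hpos, abs_sub_comm]
      _ ≤ _ := abs_integral_le_integral_abs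
  calc ∫ x in s, |f x - m| ∂μ ≤ ∫ x in s, (|f x - a| + |a - m|) ∂μ := by
        refine integral_mono (hfa m) ((hfa a).add (hconst |a - m|)) fun x => ?_
        exact abs_sub_le (f x) a m
    _ = (∫ x in s, |f x - a| ∂μ) + μ.real s * |a - m| := by
        rw [integral_add (hfa a) (hconst _), setIntegral_const, smul_eq_mul]
    _ ≤ _ := by linarith

lemma sq_sqrt_sub_sqrt_le {a b : ℝ} (ha : 0 ≤ a) (hb : 0 ≤ b) :
    (√a - √b) ^ 2 ≤ |a - b| := by
  have h : |a - b| = |√a - √b| * (√a + √b) := by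
    rw [← abs_of_nonneg (add_nonneg (Real.sqrt_nonneg a) (Real.sqrt_nonneg b)), ← abs_mul]
    congr 1
    nlinarith [Real.sq_sqrt ha, Real.sq_sqrt hb]
  rw [h, ← sq_abs, sq]
  refine mul_le_mul_of_nonneg_left (abs_le.2 ⟨?_, ?_⟩) (abs_nonneg _) <;>
    linarith [Real.sqrt_nonneg a, Real.sqrt_nonneg b]

namespace Grid

/-- The grid with `N + 1` equal subdivisions in each coordinate. -/
noncomputable def equidistant (d N : ℕ) : Grid d where
  n _ := N + 1
  npos _ := N.succ_pos
  pts _ j := (j : ℕ) / ((N : ℝ) + 1)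
  mono _ i j hij := by
    have : ((i : ℕ) : ℝ) < (j : ℕ) := by exact_mod_cast hij
    dsimp only
    gcongr
  first _ := by simp
  last _ := by
    simp only [Fin.val_last, Nat.cast_add, Nat.cast_one]
    exact div_self (by positivity)

lemma equidistant_pts_castSucc (d N : ℕ) (i : Fin d) (j : Fin ((equidistant d N).n i)) :
    (equidistant d N).pts i j.castSucc = (j : ℕ) / ((N : ℝ) + 1) :=
  rfl

lemma equidistant_pts_succ (d N : ℕ) (i : Fin d) (j : Fin ((equidistant d N).n i)) :
    (equidistant d N).pts i j.succ = (j : ℕ) / ((N : ℝ) + 1) + 1 / ((N : ℝ) + 1) := by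
  change (((j : ℕ) + 1 : ℕ) : ℝ) / ((N : ℝ) + 1) = _
  rw [Nat.cast_succ, add_div]

lemma measurableSet_cell (g : Grid d) (k : g.CellIdx) : MeasurableSet (g.cell k) :=
  MeasurableSet.univ_pi fun _ => measurableSet_Ioc

lemma volume_cell_ne_top (g : Grid d) (k : g.CellIdx) : volume (g.cell k) ≠ ⊤ := by
  rw [cell, volume_pi_pi]
  exact ENNReal.prod_ne_top fun i _ => by simp

lemma pairwise_disjoint_cell (g : Grid d) : Pairwise (Function.onFun Disjoint g.cell) := by
  intro k l hkl
  obtain ⟨i, hi⟩ := Function.ne_iff.1 hkl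
  refine Set.disjoint_left.2 fun x hx hy => ?_
  have hxi := hx i (mem_univ i)
  have hyi := hy i (mem_univ i)
  rcases lt_or_gt_of_ne hi with h | h
  · have : g.pts i (k i).succ ≤ g.pts i (l i).castSucc :=
      (g.mono i).monotone (Fin.succ_le_castSucc_iff.2 h)
    linarith [hxi.2, hyi.1]
  · have : g.pts i (l i).succ ≤ g.pts i (k i).castSucc :=
      (g.mono i).monotone (Fin.succ_le_castSucc_iff.2 h)
    linarith [hyi.2, hxi.1]

/-- The Lebesgue density of the grid-uniform version of `μ`. -/
noncomputable def density (g : Grid d) (μ : Measure (Fin d → ℝ)) (x : Fin d → ℝ) : ENNReal :=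
  ∑ k : g.CellIdx, (g.cell k).indicator (fun _ => μ (g.cell k) / volume (g.cell k)) x

lemma measurable_density (g : Grid d) (μ : Measure (Fin d → ℝ)) : Measurable (g.density μ) :=
  Finset.measurable_sum _ fun k _ => measurable_const.indicator (g.measurableSet_cell k)

lemma gridUniform_eq_withDensity (g : Grid d) (μ : Measure (Fin d → ℝ)) :
    g.gridUniform μ = volume.withDensity (g.density μ) := by
  have h : g.density μ =
      ∑' k, (g.cell k).indicator (fun _ => μ (g.cell k) / volume (g.cell k)) := by
    ext x
    rw [tsum_fintype, Finset.sum_apply, density]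
  rw [h, withDensity_tsum fun k => measurable_const.indicator (g.measurableSet_cell k)]
  simp only [gridUniform, withDensity_indicator (g.measurableSet_cell _), withDensity_const]

lemma rnDeriv_gridUniform (g : Grid d) (μ : Measure (Fin d → ℝ)) :
    (g.gridUniform μ).rnDeriv volume =ᵐ[volume] g.density μ := by
  rw [gridUniform_eq_withDensity]
  exact Measure.rnDeriv_withDensity _ (g.measurable_density μ)

lemma density_of_mem (g : Grid d) (μ : Measure (Fin d → ℝ)) {k : g.CellIdx} {x : Fin d → ℝ}
    (hx : x ∈ g.cell k) : g.density μ x = μ (g.cell k) / volume (g.cell k) := by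
  rw [density, Finset.sum_eq_single k, indicator_of_mem hx]
  · intro l _ hl
    exact indicator_of_notMem (fun h => Set.disjoint_left.1 (g.pairwise_disjoint_cell hl) h hx) _
  · simp

lemma density_of_notMem (g : Grid d) (μ : Measure (Fin d → ℝ)) {x : Fin d → ℝ}
    (hx : x ∉ ⋃ k, g.cell k) : g.density μ x = 0 := by
  rw [density]
  exact Finset.sum_eq_zero fun k _ => indicator_of_notMem (fun h => hx (mem_iUnion.2 ⟨k, h⟩)) _

lemma volume_real_equidistant_cell (N : ℕ) (k : (equidistant d N).CellIdx) :
    volume.real ((equidistant d N).cell k) = (1 / ((N : ℝ) + 1)) ^ d := by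
  rw [measureReal_def, cell, volume_pi_pi, ENNReal.toReal_prod]
  have h : ∀ i : Fin d, (volume (Ioc ((equidistant d N).pts i (k i).castSucc)
      ((equidistant d N).pts i (k i).succ))).toReal = 1 / ((N : ℝ) + 1) := by
    intro i
    rw [Real.volume_Ioc, equidistant_pts_succ, equidistant_pts_castSucc, add_sub_cancel_left,
      ENNReal.toReal_ofReal (by positivity)]
  rw [Finset.prod_congr rfl fun i _ => h i, Finset.prod_const, Finset.card_univ, Fintype.card_fin]

lemma sum_volume_real_equidistant_cell (d N : ℕ) :
    ∑ k, volume.real ((equidistant d N).cell k) = 1 := by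
  have hcard : Fintype.card (equidistant d N).CellIdx = (N + 1) ^ d := by
    change Fintype.card (Fin d → Fin (N + 1)) = _
    simp
  rw [Finset.sum_congr rfl fun k _ => volume_real_equidistant_cell N k, Finset.sum_const,
    Finset.card_univ, hcard, nsmul_eq_mul]
  push_cast
  rw [← mul_pow, mul_one_div_cancel (by positivity), one_pow]

lemma dist_le_of_mem_equidistant_cell {N : ℕ} {k : (equidistant d N).CellIdx}
    {x y : Fin d → ℝ} (hx : x ∈ (equidistant d N).cell k) (hy : y ∈ (equidistant d N).cell k) :
    dist x y ≤ 1 / ((N : ℝ) + 1) := by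
  refine (dist_pi_le_iff (by positivity)).2 fun i => ?_
  have hxi := hx i (mem_univ i)
  have hyi := hy i (mem_univ i)
  dsimp only at hxi hyi
  rw [mem_Ioc, equidistant_pts_castSucc, equidistant_pts_succ] at hxi hyi
  rw [Real.dist_eq, abs_le]
  constructor <;> linarith [hxi.1, hxi.2, hyi.1, hyi.2]

lemma mem_iUnion_equidistant_cell {N : ℕ} {x : Fin d → ℝ} (hx : ∀ i, x i ∈ Ioc (0 : ℝ) 1) :
    x ∈ ⋃ k, (equidistant d N).cell k := by
  have hN : (0 : ℝ) < (N : ℝ) + 1 := by positivity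
  have hex : ∀ i, ∃ j : Fin (N + 1),
      ((j : ℕ) : ℝ) / ((N : ℝ) + 1) < x i ∧ x i ≤ (((j : ℕ) : ℝ) + 1) / ((N : ℝ) + 1) := by
    intro i
    obtain ⟨h0, h1⟩ := hx i
    have hpos : 0 < ⌈x i * ((N : ℝ) + 1)⌉₊ := Nat.ceil_pos.2 (by positivity)
    have hle : ⌈x i * ((N : ℝ) + 1)⌉₊ ≤ N + 1 := by
      refine Nat.ceil_le.2 ?_
      push_cast
      nlinarith
    obtain ⟨j, hj⟩ := Nat.exists_eq_succ_of_ne_zero hpos.ne'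
    have hlt : j < ⌈x i * ((N : ℝ) + 1)⌉₊ := by omega
    refine ⟨⟨j, by omega⟩, (div_lt_iff₀ hN).2 (Nat.lt_ceil.1 hlt), (le_div_iff₀ hN).2 ?_⟩
    refine (Nat.le_ceil _).trans ?_
    rw [hj]
    push_cast
    exact le_rfl
  choose k hk using hex
  refine mem_iUnion.2 ⟨k, fun i _ => ?_⟩
  exact ⟨(hk i).1, (hk i).2.trans_eq
    ((add_div _ _ _).trans (equidistant_pts_succ d N i (k i)).symm)⟩

end Grid

lemma IsCopula.measure_compl_iUnion_equidistant_cell {C : Measure (Fin d → ℝ)} (hC : IsCopula C)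
    (N : ℕ) : C (⋃ k, (Grid.equidistant d N).cell k)ᶜ = 0 := by
  refine measure_mono_null (t := ⋃ i, (fun x : Fin d → ℝ => x i) ⁻¹' (Ioc (0 : ℝ) 1)ᶜ) ?_ ?_
  · intro x hx
    by_contra h
    simp only [mem_iUnion, mem_preimage, mem_compl_iff, not_exists, not_not] at h
    exact hx (Grid.mem_iUnion_equidistant_cell h)
  · refine measure_iUnion_null fun i => ?_
    rw [← Measure.map_apply (measurable_pi_apply i) measurableSet_Ioc.compl, hC.2 i,
      ← restrict_Ioc_eq_restrict_Icc, Measure.restrict_apply measurableSet_Ioc.compl]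
    simp

lemma Grid.integrable_toReal_density (g : Grid d) (C : Measure (Fin d → ℝ)) [IsFiniteMeasure C] :
    Integrable (fun x => (g.density C x).toReal) := by
  refine integrable_toReal_of_lintegral_ne_top (g.measurable_density C).aemeasurable ?_
  simp only [Grid.density]
  rw [lintegral_finsetSum _ fun k _ => measurable_const.indicator (g.measurableSet_cell k)]
  refine ENNReal.sum_ne_top.2 fun k _ => ?_
  rw [lintegral_indicator (g.measurableSet_cell k), setLIntegral_const]
  rw [mul_comm]
  exact (ENNReal.mul_div_le.trans_lt (measure_lt_top C _)).ne

/-- Averaging the density of a copula over the cells of a fine equidistant grid approximates it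
in `L¹`. -/
lemma IsCopula.exists_integral_abs_rnDeriv_sub_density_lt {C : Measure (Fin d → ℝ)}
    (hC : IsCopula C) (hac : C ≪ volume) {η : ℝ} (hη : 0 < η) :
    ∃ N : ℕ, ∫ x, |(C.rnDeriv volume x).toReal -
      ((Grid.equidistant d N).density C x).toReal| < η := by
  have := hC.1
  set f : (Fin d → ℝ) → ℝ := fun x => (C.rnDeriv volume x).toReal with hf
  have hfi : Integrable f := Measure.integrable_toReal_rnDeriv
  obtain ⟨φ, hφs, hφ, hφc, hφi⟩ :=
    hfi.exists_hasCompactSupport_integral_sub_le (ε := η / 6) (by positivity)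
  obtain ⟨δ, hδ, hφδ⟩ := Metric.uniformContinuous_iff.1
    (hφs.uniformContinuous_of_continuous hφc) (η / 6) (by positivity)
  obtain ⟨N, hN⟩ := exists_nat_one_div_lt hδ
  refine ⟨N, ?_⟩
  set g := Grid.equidistant d N
  have hcell : ∀ k : g.CellIdx, ∫ x in g.cell k, |f x - (g.density C x).toReal| ≤
      2 * ((∫ x in g.cell k, |f x - φ x|) + volume.real (g.cell k) * (η / 6)) := by
    intro k
    have hv : volume.real (g.cell k) ≠ 0 := by
      rw [Grid.volume_real_equidistant_cell]
      positivity
    have ht := g.volume_cell_ne_top k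
    have hmean : ∫ x in g.cell k, |f x - (g.density C x).toReal| =
        ∫ x in g.cell k, |f x - (∫ y in g.cell k, f y) / volume.real (g.cell k)| := by
      refine setIntegral_congr_fun (g.measurableSet_cell k) fun x hx => ?_
      simp only [hf]
      rw [g.density_of_mem C hx, Measure.setIntegral_toReal_rnDeriv hac, ENNReal.toReal_div,
        measureReal_def, measureReal_def]
    obtain ⟨y, hy⟩ : (g.cell k).Nonempty := by
      by_contra h
      exact hv (by simp [not_nonempty_iff_eq_empty.1 h])
    have hc : ∀ c : ℝ, IntegrableOn (fun _ => c) (g.cell k) := fun c => integrableOn_const ht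
    rw [hmean]
    refine (setIntegral_abs_sub_average_le hv ht hfi.integrableOn (φ y)).trans ?_
    refine mul_le_mul_of_nonneg_left ?_ zero_le_two
    have hfφ : IntegrableOn (fun x => |f x - φ x|) (g.cell k) := (hfi.sub hφi).abs.integrableOn
    rw [← smul_eq_mul (volume.real (g.cell k)), ← setIntegral_const, ← integral_add hfφ (hc _)]
    refine setIntegral_mono_on (hfi.integrableOn.sub (hc _)).abs (hfφ.add (hc _))
      (g.measurableSet_cell k) fun x hx => ?_
    have h := hφδ ((Grid.dist_le_of_mem_equidistant_cell hx hy).trans_lt hN)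
    rw [Real.dist_eq] at h
    linarith [abs_sub_le (f x) (φ x) (φ y)]
  have hout : ∀ᵐ x, x ∉ (⋃ k, g.cell k) → |f x - (g.density C x).toReal| = 0 := by
    have hU : MeasurableSet (⋃ k, g.cell k)ᶜ := (MeasurableSet.iUnion g.measurableSet_cell).compl
    have h0 : ∫⁻ x in (⋃ k, g.cell k)ᶜ, C.rnDeriv volume x = 0 := by
      rw [Measure.setLIntegral_rnDeriv hac, hC.measure_compl_iUnion_equidistant_cell N]
    rw [setLIntegral_eq_zero_iff hU (Measure.measurable_rnDeriv _ _)] at h0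
    filter_upwards [h0] with x hx hxU
    simp [hf, hx hxU, g.density_of_notMem C hxU]
  have hfd : Integrable fun x => |f x - (g.density C x).toReal| :=
    (hfi.sub (g.integrable_toReal_density C)).abs
  have hfφ : Integrable fun x => |f x - φ x| := (hfi.sub hφi).abs
  have hsum : ∑ k, ∫ x in g.cell k, |f x - φ x| ≤ η / 6 := by
    rw [← integral_iUnion_fintype g.measurableSet_cell g.pairwise_disjoint_cell
      fun k => hfφ.integrableOn]
    exact (setIntegral_le_integral hfφ (ae_of_all _ fun _ => abs_nonneg _)).trans hφ
  rw [← setIntegral_eq_integral_of_ae_compl_eq_zero hout,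
    integral_iUnion_fintype g.measurableSet_cell g.pairwise_disjoint_cell
      fun k => hfd.integrableOn]
  refine (Finset.sum_le_sum fun k _ => hcell k).trans_lt ?_
  rw [← Finset.mul_sum, Finset.sum_add_distrib, ← Finset.sum_mul,
    Grid.sum_volume_real_equidistant_cell]
  linarith

/-- every copula absolutely continuous w.r.t. Lebesgue measure can be
approximated arbitrarily well in Hellinger distance by grid-uniform copulas. -/
theorem gridUniform_dense_absolutelyContinuous (C : Measure (Fin d → ℝ))
    (hC : IsCopula C) (hac : C ≪ volume) (ε : ℝ) (hε : 0 < ε) :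
    ∃ g : Grid d, hellingerSq C (g.gridUniform C) < ε ^ 2 := by
  have := hC.1
  obtain ⟨N, hN⟩ := hC.exists_integral_abs_rnDeriv_sub_density_lt hac (pow_pos hε 2)
  set g := Grid.equidistant d N
  refine ⟨g, ?_⟩
  have hle : ∫ x, (√(C.rnDeriv volume x).toReal - √((g.gridUniform C).rnDeriv volume x).toReal) ^ 2
      ≤ ∫ x, |(C.rnDeriv volume x).toReal - (g.density C x).toReal| := by
    refine integral_mono_of_nonneg (ae_of_all _ fun x => sq_nonneg _)
      (Measure.integrable_toReal_rnDeriv.sub (g.integrable_toReal_density C)).abs ?_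
    filter_upwards [g.rnDeriv_gridUniform C] with x hx
    rw [hx]
    exact sq_sqrt_sub_sqrt_le ENNReal.toReal_nonneg ENNReal.toReal_nonneg
  rw [hellingerSq]
  linarith [pow_pos hε 2]
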